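/- Fix p ∈ (0,1) and let n = 2, so S = k[x₁,x₂]. For each D ≥ 1 let 𝔍 = 𝔍(D) be the random monomial ideal of the ER-type model with parameter p. Then lim_{D→∞} E[β₁(S/𝔍)] = (p/(1−p)²) · Σ_{k=1}^{∞} (1−p)^k / (1 − (1−p)^k) − p/(1−p). -/

import Mathlib

open Finset MvPolynomial Filter

noncomputable section

/-- The set of exponent vectors of nonconstant monomials in `n` variables of total degree
at most `D`. -/
def monSet (n D : ℕ) : Finset (Fin n → ℕ) :=
  (Fintype.piFinset fun _ : Fin n => Finset.range (D + 1)).filter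
    fun α => 0 < ∑ i, α i ∧ ∑ i, α i ≤ D

/-- The monomial `x^α` of `MvPolynomial (Fin n) K` with exponent vector `α`. -/
def mono (K : Type*) [CommRing K] {n : ℕ} (α : Fin n → ℕ) : MvPolynomial (Fin n) K :=
  MvPolynomial.monomial (Finsupp.equivFunOnFinite.symm α) 1

/-- The monomial ideal generated by a set of exponent vectors. -/
def idealOf (K : Type*) [CommRing K] {n : ℕ} (B : Finset (Fin n → ℕ)) :
    Ideal (MvPolynomial (Fin n) K) :=
  Ideal.span (mono K '' (B : Set (Fin n → ℕ)))

open Classical in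
/-- The probability, under the ER-type model `ℐ(n,D,p)`, of the event `E` on random
generating sets `𝔅 ⊆ M(n,D)`. -/
def ERprob (n D : ℕ) (p : ℝ) (E : Set (Finset (Fin n → ℕ))) : ℝ :=
  ∑ B ∈ (monSet n D).powerset.filter (· ∈ E),
    p ^ B.card * (1 - p) ^ ((monSet n D).card - B.card)

/-- `I` is a monomial ideal. -/
def IsMonomialIdeal (K : Type*) [CommRing K] {n : ℕ}
    (I : Ideal (MvPolynomial (Fin n) K)) : Prop :=
  ∃ G : Set (Fin n → ℕ), I = Ideal.span (mono K '' G)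

/-- `x^α` is a minimal monomial generator of `I`: it lies in `I` and no proper divisor does. -/
def IsMinGen (K : Type*) [CommRing K] {n : ℕ} (I : Ideal (MvPolynomial (Fin n) K))
    (α : Fin n → ℕ) : Prop :=
  mono K α ∈ I ∧ ∀ β : Fin n → ℕ, (∀ i, β i ≤ α i) → β ≠ α → mono K β ∉ I

/-- `β₁(S/I)`: the number of minimal monomial generators of `I`. -/
def beta1 (K : Type*) [CommRing K] {n : ℕ} (I : Ideal (MvPolynomial (Fin n) K)) : ℕ :=
  {α : Fin n → ℕ | IsMinGen K I α}.ncard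

/-- `β_{1,d}(S/I)`: the number of minimal monomial generators of `I` of degree `d`. -/
def beta1d (K : Type*) [CommRing K] {n : ℕ} (I : Ideal (MvPolynomial (Fin n) K)) (d : ℕ) : ℕ :=
  {α : Fin n → ℕ | IsMinGen K I α ∧ ∑ i, α i = d}.ncard

/-- `h_I(d)`: the number of monomials of degree exactly `d` not contained in `I`. -/
def hilb (K : Type*) [CommRing K] {n : ℕ} (I : Ideal (MvPolynomial (Fin n) K)) (d : ℕ) : ℕ :=
  {α : Fin n → ℕ | ∑ i, α i = d ∧ mono K α ∉ I}.ncard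

open Classical in
/-- The expectation, under the ER-type model `ℐ(n,D,p)`, of a real random variable `X`
of the random generating set `𝔅 ⊆ M(n,D)`. -/
def ERexp (n D : ℕ) (p : ℝ) (X : Finset (Fin n → ℕ) → ℝ) : ℝ :=
  ∑ B ∈ (monSet n D).powerset,
    p ^ B.card * (1 - p) ^ ((monSet n D).card - B.card) * X B

theorem mono_mem_idealOf_iff (K : Type*) [Field K] {n : ℕ} (B : Finset (Fin n → ℕ))
    (α : Fin n → ℕ) : mono K α ∈ idealOf K B ↔ ∃ β ∈ B, β ≤ α := by
  classical
  have himage : mono K '' (B : Set (Fin n → ℕ)) = (fun s => monomial s (1 : K)) ''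
      ((Finsupp.equivFunOnFinite.symm : (Fin n → ℕ) → (Fin n →₀ ℕ)) '' (B : Set _)) := by
    rw [Set.image_image]
    rfl
  rw [idealOf, himage, mem_ideal_span_monomial_image, mono, support_monomial, if_neg one_ne_zero]
  simp only [Finset.mem_singleton, forall_eq, Set.exists_mem_image, Finset.mem_coe]
  rfl

theorem mem_monSet {n D : ℕ} {α : Fin n → ℕ} :
    α ∈ monSet n D ↔ α ≠ 0 ∧ ∑ i, α i ≤ D := by
  simp only [monSet, Finset.mem_filter, Fintype.mem_piFinset, Finset.mem_range,
    Order.lt_add_one_iff,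
    Finset.sum_pos_iff, Finset.mem_univ, true_and]
  constructor
  · rintro ⟨-, ⟨i, hi⟩, h⟩
    exact ⟨fun h0 => by simp [h0] at hi, h⟩
  · rintro ⟨h0, h⟩
    refine ⟨fun i => (Finset.single_le_sum (fun _ _ => Nat.zero_le _) (Finset.mem_univ i)).trans h,
      ?_, h⟩
    obtain ⟨i, hi⟩ := Function.ne_iff.1 h0
    exact ⟨i, Nat.pos_of_ne_zero hi⟩

theorem isMinGen_idealOf_iff (K : Type*) [Field K] {n D : ℕ} {B : Finset (Fin n → ℕ)}
    (hB : B ⊆ monSet n D) (α : Fin n → ℕ) :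
    IsMinGen K (idealOf K B) α ↔ α ∈ B ∧ Disjoint B (Finset.Ioo 0 α) := by
  simp only [IsMinGen, mono_mem_idealOf_iff, Finset.disjoint_left, Finset.mem_Ioo]
  constructor
  · rintro ⟨⟨β, hβ, hle⟩, hmin⟩
    have hαB : α ∈ B := by
      by_contra h
      exact hmin β hle (fun h' => h (h' ▸ hβ)) ⟨β, hβ, le_rfl⟩
    exact ⟨hαB, fun γ hγ hlt => hmin γ hlt.2.le hlt.2.ne ⟨γ, hγ, le_rfl⟩⟩
  · rintro ⟨hα, hdisj⟩
    refine ⟨⟨α, hα, le_rfl⟩, ?_⟩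
    rintro β hle hne ⟨γ, hγ, hγβ⟩
    exact hdisj hγ ⟨pos_of_ne_zero (mem_monSet.1 (hB hγ)).1,
      hγβ.trans_lt (lt_of_le_of_ne hle hne)⟩

theorem beta1_idealOf (K : Type*) [Field K] {n D : ℕ} {B : Finset (Fin n → ℕ)}
    (hB : B ⊆ monSet n D) :
    (beta1 K (idealOf K B) : ℝ) =
      ∑ α ∈ monSet n D, if α ∈ B ∧ Disjoint B (Finset.Ioo 0 α) then 1 else 0 := by
  have hset : {α : Fin n → ℕ | IsMinGen K (idealOf K B) α} =
      ((monSet n D).filter fun α => α ∈ B ∧ Disjoint B (Finset.Ioo 0 α) : Finset _) := by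
    ext α
    simp only [Set.mem_ofPred_eq, isMinGen_idealOf_iff K hB, Finset.coe_filter]
    exact ⟨fun h => ⟨hB h.1, h⟩, fun h => h.2⟩
  rw [beta1, hset, Set.ncard_coe_finset, Finset.card_filter]
  push_cast
  rfl

/-- In a Bernoulli random subset of `M`, a given element is present and a given set not
containing it is absent with the expected probability. -/
theorem sum_powerset_bernoulli {ι : Type*} [DecidableEq ι] {M T : Finset ι} {a : ι} (p : ℝ)
    (ha : a ∈ M) (hT : T ⊆ M) (haT : a ∉ T) :
    ∑ B ∈ M.powerset, p ^ B.card * (1 - p) ^ (M.card - B.card) *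
      (if a ∈ B ∧ Disjoint B T then 1 else 0) = p * (1 - p) ^ T.card := by
  let f : ι → ℝ := fun i => if i ∈ T then 0 else p
  let g : ι → ℝ := fun i => if i = a then 0 else 1 - p
  have hsplit : ∏ i ∈ M, (f i + g i) = p * (1 - p) ^ T.card := by
    have h : ∀ i, f i + g i = (if i = a then p else 1) * (if i ∈ T then 1 - p else 1) := by
      intro i
      by_cases hi : i = a
      · subst hi
        simp [f, g, haT]
      · by_cases hiT : i ∈ T <;> simp [f, g, hi, hiT]
    simp_rw [h]
    rw [Finset.prod_mul_distrib, Finset.prod_ite_eq', if_pos ha, Finset.prod_ite_mem,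
      Finset.inter_eq_right.2 hT, Finset.prod_const]
  rw [← hsplit, Finset.prod_add]
  refine Finset.sum_congr rfl fun B hB => ?_
  rw [Finset.mem_powerset] at hB
  split_ifs with h
  · have hf : ∏ i ∈ B, f i = p ^ B.card := by
      rw [← Finset.prod_const]
      exact Finset.prod_congr rfl fun i hi => if_neg (Finset.disjoint_left.1 h.2 hi)
    have hg : ∏ i ∈ M \ B, g i = (1 - p) ^ (M.card - B.card) := by
      rw [← Finset.card_sdiff_of_subset hB, ← Finset.prod_const]
      refine Finset.prod_congr rfl fun i hi => if_neg ?_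
      rintro rfl
      exact (Finset.mem_sdiff.1 hi).2 h.1
    rw [hf, hg, mul_one]
  · rw [mul_zero, eq_comm, mul_eq_zero]
    by_cases haB : a ∈ B
    · obtain ⟨i, hiB, hiT⟩ := Finset.not_disjoint_iff.1 fun hd => h ⟨haB, hd⟩
      exact Or.inl (Finset.prod_eq_zero hiB (if_pos hiT))
    · exact Or.inr (Finset.prod_eq_zero (Finset.mem_sdiff.2 ⟨ha, haB⟩) (if_pos rfl))

theorem ERexp_beta1 (K : Type*) [Field K] (n D : ℕ) (p : ℝ) :
    ERexp n D p (fun B => (beta1 K (idealOf K B) : ℝ)) =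
      ∑ α ∈ monSet n D, p * (1 - p) ^ (∏ i, (α i + 1) - 2) := by
  have hswap : ERexp n D p (fun B => (beta1 K (idealOf K B) : ℝ)) =
      ∑ B ∈ (monSet n D).powerset, ∑ α ∈ monSet n D,
        p ^ B.card * (1 - p) ^ ((monSet n D).card - B.card) *
          (if α ∈ B ∧ Disjoint B (Finset.Ioo 0 α) then 1 else 0) := by
    refine Finset.sum_congr rfl fun B hB => ?_
    simp only [beta1_idealOf K (Finset.mem_powerset.1 hB), Finset.mul_sum]
  rw [hswap, Finset.sum_comm]
  refine Finset.sum_congr rfl fun α hα => ?_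
  have hsub : Finset.Ioo 0 α ⊆ monSet n D := by
    intro β hβ
    rw [Finset.mem_Ioo] at hβ
    exact mem_monSet.2 ⟨hβ.1.ne',
      (Finset.sum_le_sum fun i _ => hβ.2.le i).trans (mem_monSet.1 hα).2⟩
  rw [sum_powerset_bernoulli p hα hsub (by simp), Pi.card_Ioo]
  simp

theorem hasSum_pow_mul_succ {q : ℝ} (hq0 : 0 < q) (hq1 : q < 1) :
    HasSum (fun x : ℕ × ℕ => q ^ ((x.1 + 1) * (x.2 + 1)))
      (∑' j : ℕ, q ^ (j + 1) / (1 - q ^ (j + 1))) := by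
  have hrow : ∀ a : ℕ, HasSum (fun b : ℕ => q ^ ((a + 1) * (b + 1)))
      (q ^ (a + 1) / (1 - q ^ (a + 1))) := by
    intro a
    have h := (hasSum_geometric_of_lt_one (pow_nonneg hq0.le (a + 1))
      (pow_lt_one₀ hq0.le hq1 a.succ_ne_zero)).mul_left (q ^ (a + 1))
    rw [← div_eq_mul_inv] at h
    refine h.congr_fun ?_
    intro b
    rw [← pow_mul, ← pow_add]
    ring
  have hsum : Summable fun x : ℕ × ℕ => q ^ ((x.1 + 1) * (x.2 + 1)) := by
    rw [summable_prod_of_nonneg fun x => pow_nonneg hq0.le _]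
    refine ⟨fun a => (hrow a).summable, ?_⟩
    simp only [(hrow _).tsum_eq]
    refine Summable.of_nonneg_of_le (fun a => ?_) (fun a => ?_)
      (((summable_geometric_of_lt_one hq0.le hq1).mul_left q).div_const (1 - q))
    · exact div_nonneg (pow_nonneg hq0.le _) (sub_nonneg.2 (pow_le_one₀ hq0.le hq1.le))
    · rw [pow_succ']
      have : q * q ^ a ≤ q := mul_le_of_le_one_right hq0.le (pow_le_one₀ hq0.le hq1.le)
      have : 0 < 1 - q := sub_pos.2 hq1
      gcongr
  rw [(hsum.hasSum.prod_fiberwise hrow).tsum_eq]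
  exact hsum.hasSum

theorem hasSum_expected_minGen {p : ℝ} (hp0 : 0 < p) (hp1 : p < 1) :
    HasSum (fun α : Fin 2 → ℕ => if α = 0 then 0 else p * (1 - p) ^ (∏ i, (α i + 1) - 2))
      (p / (1 - p) ^ 2 *
        (∑' j : ℕ, (1 - p) ^ (j + 1) / (1 - (1 - p) ^ (j + 1))) - p / (1 - p)) := by
  have hq : 1 - p ≠ 0 := (sub_pos.2 hp1).ne'
  have h := (finTwoArrowEquiv ℕ).hasSum_iff.2
    (hasSum_pow_mul_succ (sub_pos.2 hp1) (sub_lt_self 1 hp0))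
  have h' := (h.mul_left (p / (1 - p) ^ 2)).sub (hasSum_ite_eq (0 : Fin 2 → ℕ) (p / (1 - p)))
  refine h'.congr_fun ?_
  intro α
  by_cases hα : α = 0
  · subst hα
    simp
    field_simp
    simp
  · have hprod : 2 ≤ (α 0 + 1) * (α 1 + 1) := by
      by_contra! hlt
      refine hα (funext fun i => ?_)
      fin_cases i <;> simp <;> nlinarith
    obtain ⟨m, hm⟩ := Nat.exists_eq_add_of_le hprod
    simp [hα, hm, finTwoArrowEquiv, Fin.prod_univ_two, pow_add]
    field_simp

theorem tendsto_insert_zero_monSet (n : ℕ) :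
    Tendsto (fun D : ℕ => insert 0 (monSet n D)) atTop atTop := by
  refine tendsto_atTop_finset_of_monotone (fun D E hDE => ?_) fun α => ⟨∑ i, α i, ?_⟩
  · refine Finset.insert_subset_insert _ fun α hα => ?_
    exact mem_monSet.2 ⟨(mem_monSet.1 hα).1, (mem_monSet.1 hα).2.trans hDE⟩
  · by_cases hα : α = 0
    · simp [hα]
    · exact Finset.mem_insert_of_mem (mem_monSet.2 ⟨hα, le_rfl⟩)

/-- Corollary 4.2. For `n = 2` and fixed `p ∈ (0,1)`,
`lim_{D→∞} E[β₁(S/𝔍)] = (p/(1-p)²) Σ_{k=1}^∞ (1-p)^k/(1-(1-p)^k) - p/(1-p)`. -/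
theorem stmt12 (K : Type*) [Field K] (p : ℝ) (hp0 : 0 < p) (hp1 : p < 1) :
    Filter.Tendsto (fun D : ℕ => ERexp 2 D p fun B => (beta1 K (idealOf K B) : ℝ))
      Filter.atTop
      (nhds (p / (1 - p) ^ 2 *
          (∑' j : ℕ, (1 - p) ^ (j + 1) / (1 - (1 - p) ^ (j + 1))) - p / (1 - p))) := by
  refine ((hasSum_expected_minGen hp0 hp1).comp (tendsto_insert_zero_monSet 2)).congr fun D => ?_
  rw [ERexp_beta1, Function.comp_apply, Finset.sum_insert (fun h => (mem_monSet.1 h).1 rfl),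
    if_pos rfl, zero_add]
  exact Finset.sum_congr rfl fun α hα => if_neg (mem_monSet.1 hα).1

end
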